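/- Let 1 ≤ p < ∞, m ∈ ℕ, 0 ≤ ℓ < d and a ∈ ℝ. Then there exists a constant c such that ‖u·v | 𝒦^m_{a,p}(ℝ^d,ℝ^ℓ_*)‖ ≤ c ‖v | 𝒦^m_{0,∞}(ℝ^d,ℝ^ℓ_*)‖ · ‖u | 𝒦^m_{a,p}(ℝ^d,ℝ^ℓ_*)‖ holds for all u ∈ 𝒦^m_{a,p}(ℝ^d,ℝ^ℓ_*) and all v ∈ 𝒦^m_{0,∞}(ℝ^d,ℝ^ℓ_*). -/

import Mathlib

open MeasureTheory Metric Set Filter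
open scoped Topology ENNReal NNReal

noncomputable section

/-- `d`-dimensional Euclidean space. -/
abbrev Ed (d : ℕ) : Type := EuclideanSpace ℝ (Fin d)

/-- The finite set of all multi-indices `α : Fin d → ℕ` with `|α| = ∑ i, α i ≤ m`. -/
def multiIdx (d m : ℕ) : Finset (Fin d → ℕ) :=
  (Fintype.piFinset fun _ : Fin d => Finset.range (m + 1)).filter fun α => ∑ i, α i ≤ m

/-- First-order partial derivative in the `i`-th coordinate direction. -/
def pderivI (d : ℕ) (i : Fin d) (f : Ed d → ℝ) : Ed d → ℝ :=
  fun x => fderiv ℝ f x (EuclideanSpace.single i 1)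

/-- Iterated partial derivative `∂^α`. -/
def pderivA (d : ℕ) (α : Fin d → ℕ) (f : Ed d → ℝ) : Ed d → ℝ :=
  ((List.finRange d).foldr (fun i g => (pderivI d i)^[α i] ∘ g) id) f

/-- Smooth compactly supported test functions with support inside `Ω`. -/
def IsTestFun (d : ℕ) (Ω : Set (Ed d)) (φ : Ed d → ℝ) : Prop :=
  ContDiff ℝ (⊤ : ℕ∞) φ ∧ HasCompactSupport φ ∧ tsupport φ ⊆ Ω

/-- `v` is the `α`-th weak (distributional) derivative of `u` on `Ω`. -/
def HasWeakDerivOn (d : ℕ) (Ω : Set (Ed d)) (α : Fin d → ℕ) (u v : Ed d → ℝ) : Prop :=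
  LocallyIntegrableOn u Ω volume ∧ LocallyIntegrableOn v Ω volume ∧
    ∀ φ : Ed d → ℝ, IsTestFun d Ω φ →
      ∫ x in Ω, u x * pderivA d α φ x = (-1 : ℝ) ^ (∑ i, α i) * ∫ x in Ω, v x * φ x

/-- `D` is a family of weak derivatives of `u` on `Ω` for all multi-indices of order `≤ m`. -/
def IsWeakDerivFamily (d : ℕ) (Ω : Set (Ed d)) (m : ℕ) (u : Ed d → ℝ)
    (D : (Fin d → ℕ) → Ed d → ℝ) : Prop :=
  ∀ α ∈ multiIdx d m, HasWeakDerivOn d Ω α u (D α)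

/-- `x ↦ (ρ(x)^(|α|-a) |v(x)|)^p`, the integrand in the Kondratiev norm. -/
def kIntegrand (d : ℕ) (ρ : Ed d → ℝ) (a p : ℝ) (α : Fin d → ℕ) (v : Ed d → ℝ) : Ed d → ℝ :=
  fun x => (ρ x ^ (((∑ i, α i : ℕ) : ℝ) - a) * |v x|) ^ p

/-- The Kondratiev norm computed from a family `D` of weak derivatives. -/
def KnormP (d : ℕ) (Ω : Set (Ed d)) (ρ : Ed d → ℝ) (m : ℕ) (a p : ℝ)
    (D : (Fin d → ℕ) → Ed d → ℝ) : ℝ :=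
  (∑ α ∈ multiIdx d m, ∫ x in Ω, kIntegrand d ρ a p α (D α) x) ^ (1 / p)

/-- `D` witnesses membership of `u` in the Kondratiev space `𝒦^m_{a,p}(Ω, M)`
    (with weight function `ρ`). -/
def KMemData (d : ℕ) (Ω : Set (Ed d)) (ρ : Ed d → ℝ) (m : ℕ) (a p : ℝ)
    (u : Ed d → ℝ) (D : (Fin d → ℕ) → Ed d → ℝ) : Prop :=
  IsWeakDerivFamily d Ω m u D ∧
    ∀ α ∈ multiIdx d m, IntegrableOn (kIntegrand d ρ a p α (D α)) Ω volume

/-- Membership in the Kondratiev space `𝒦^m_{a,p}(Ω, M)` with weight `ρ`, `p < ∞`. -/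
def MemK (d : ℕ) (Ω : Set (Ed d)) (ρ : Ed d → ℝ) (m : ℕ) (a p : ℝ) (u : Ed d → ℝ) : Prop :=
  ∃ D, KMemData d Ω ρ m a p u D

open Classical in
/-- The Kondratiev norm of `u` (computed from a choice of weak derivative family;
    it is a.e. independent of this choice). -/
def Knorm (d : ℕ) (Ω : Set (Ed d)) (ρ : Ed d → ℝ) (m : ℕ) (a p : ℝ) (u : Ed d → ℝ) : ℝ :=
  if h : MemK d Ω ρ m a p u then KnormP d Ω ρ m a p h.choose else 0

/-- `x ↦ ρ(x)^(|α|-a) v(x)`, the function whose `L_∞` norm enters the norm for `p = ∞`. -/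
def kIntegrandInf (d : ℕ) (ρ : Ed d → ℝ) (a : ℝ) (α : Fin d → ℕ) (v : Ed d → ℝ) : Ed d → ℝ :=
  fun x => ρ x ^ (((∑ i, α i : ℕ) : ℝ) - a) * v x

/-- `D` witnesses membership of `u` in `𝒦^m_{a,∞}(Ω, M)`. -/
def KMemDataInf (d : ℕ) (Ω : Set (Ed d)) (ρ : Ed d → ℝ) (m : ℕ) (a : ℝ)
    (u : Ed d → ℝ) (D : (Fin d → ℕ) → Ed d → ℝ) : Prop :=
  IsWeakDerivFamily d Ω m u D ∧
    ∀ α ∈ multiIdx d m,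
      eLpNorm (kIntegrandInf d ρ a α (D α)) ⊤ (volume.restrict Ω) < ⊤

/-- Membership in `𝒦^m_{a,∞}(Ω, M)`. -/
def MemKInf (d : ℕ) (Ω : Set (Ed d)) (ρ : Ed d → ℝ) (m : ℕ) (a : ℝ) (u : Ed d → ℝ) : Prop :=
  ∃ D, KMemDataInf d Ω ρ m a u D

/-- The `𝒦^m_{a,∞}` norm computed from a family `D` of weak derivatives. -/
def KnormInfP (d : ℕ) (Ω : Set (Ed d)) (ρ : Ed d → ℝ) (m : ℕ) (a : ℝ)
    (D : (Fin d → ℕ) → Ed d → ℝ) : ℝ :=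
  ∑ α ∈ multiIdx d m, (eLpNorm (kIntegrandInf d ρ a α (D α)) ⊤ (volume.restrict Ω)).toReal

open Classical in
/-- The `𝒦^m_{a,∞}(Ω, M)` norm of `u`. -/
def KnormInf (d : ℕ) (Ω : Set (Ed d)) (ρ : Ed d → ℝ) (m : ℕ) (a : ℝ) (u : Ed d → ℝ) : ℝ :=
  if h : MemKInf d Ω ρ m a u then KnormInfP d Ω ρ m a h.choose else 0

/-- The subspace `ℝ^ℓ_* = {x : x₁ = ⋯ = x_{d-ℓ} = 0}` of `ℝ^d`. -/
def RStar (d ℓ : ℕ) : Set (Ed d) := {x | ∀ i : Fin d, (i : ℕ) < d - ℓ → x i = 0}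

/-- The weight `ρ(x) = min(1, |x'|)` for the model case `(ℝ^d, ℝ^ℓ_*)`. -/
def rhoModel (d ℓ : ℕ) (x : Ed d) : ℝ :=
  min 1 (Real.sqrt (∑ i ∈ Finset.univ.filter (fun i : Fin d => (i : ℕ) < d - ℓ), (x i) ^ 2))

/-- The model domain `ℝ^d ∖ ℝ^ℓ_*`. -/
def ModelDomain (d ℓ : ℕ) : Set (Ed d) := (RStar d ℓ)ᶜ

/-- Membership in the model Kondratiev space `𝒦^m_{a,p}(ℝ^d, ℝ^ℓ_*)`, `p < ∞`. -/
def MemKM (d ℓ m : ℕ) (a p : ℝ) (u : Ed d → ℝ) : Prop :=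
  MemK d (ModelDomain d ℓ) (rhoModel d ℓ) m a p u

/-- The norm of the model Kondratiev space `𝒦^m_{a,p}(ℝ^d, ℝ^ℓ_*)`, `p < ∞`. -/
def KnormM (d ℓ m : ℕ) (a p : ℝ) (u : Ed d → ℝ) : ℝ :=
  Knorm d (ModelDomain d ℓ) (rhoModel d ℓ) m a p u

/-- Membership in the model Kondratiev space `𝒦^m_{a,∞}(ℝ^d, ℝ^ℓ_*)`. -/
def MemKMInf (d ℓ m : ℕ) (a : ℝ) (u : Ed d → ℝ) : Prop :=
  MemKInf d (ModelDomain d ℓ) (rhoModel d ℓ) m a u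

/-- The norm of the model Kondratiev space `𝒦^m_{a,∞}(ℝ^d, ℝ^ℓ_*)`. -/
def KnormMInf (d ℓ m : ℕ) (a : ℝ) (u : Ed d → ℝ) : ℝ :=
  KnormInf d (ModelDomain d ℓ) (rhoModel d ℓ) m a u

/-! ### Calculus of partial derivatives of smooth functions -/

lemma pderivI_contDiff {d : ℕ} (i : Fin d) {f : Ed d → ℝ} (hf : ContDiff ℝ (⊤ : ℕ∞) f) :
    ContDiff ℝ (⊤ : ℕ∞) (pderivI d i f) := by
  have h := hf.fderiv_right (m := ((⊤ : ℕ∞) : WithTop ℕ∞)) (by simp)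
  exact h.clm_apply contDiff_const

lemma pderivI_comm {d : ℕ} (i j : Fin d) {f : Ed d → ℝ} (hf : ContDiff ℝ (⊤ : ℕ∞) f) :
    pderivI d i (pderivI d j f) = pderivI d j (pderivI d i f) := by
  funext x
  have h := hf.fderiv_right (m := ((⊤ : ℕ∞) : WithTop ℕ∞)) (by simp)
  have hd : DifferentiableAt ℝ (fderiv ℝ f) x := h.differentiable (by simp) x
  have key : ∀ a b : Ed d, fderiv ℝ (fun y => fderiv ℝ f y a) x b
      = fderiv ℝ (fderiv ℝ f) x b a := by
    intro a b
    rw [fderiv_clm_apply hd (differentiableAt_const _)]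
    simp
  have hs : IsSymmSndFDerivAt ℝ f x := hf.contDiffAt.isSymmSndFDerivAt (by
    simp only [minSmoothness_of_isRCLikeNormedField]
    exact WithTop.coe_le_coe.2 (le_top : (2 : ℕ∞) ≤ ⊤))
  unfold pderivI
  rw [key, key]
  exact hs _ _

lemma pderivI_tsupport {d : ℕ} (i : Fin d) (f : Ed d → ℝ) :
    tsupport (pderivI d i f) ⊆ tsupport f := by
  refine closure_minimal ?_ (isClosed_tsupport f)
  intro x hx
  by_contra hxn
  apply hx
  have : fderiv ℝ f x = 0 := by
    by_contra h0
    exact hxn (support_fderiv_subset ℝ h0)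
  simp [pderivI, this]

lemma pderivI_testFun {d : ℕ} {Ω : Set (Ed d)} (i : Fin d) {f : Ed d → ℝ}
    (hf : IsTestFun d Ω f) : IsTestFun d Ω (pderivI d i f) :=
  ⟨pderivI_contDiff i hf.1, hf.2.1.of_isClosed_subset (isClosed_tsupport _) (pderivI_tsupport i f),
    (pderivI_tsupport i f).trans hf.2.2⟩

/-- Partial foldr over a list of coordinates. -/
def pderivL (d : ℕ) (l : List (Fin d)) (α : Fin d → ℕ) (f : Ed d → ℝ) : Ed d → ℝ :=
  (l.foldr (fun i g => (pderivI d i)^[α i] ∘ g) id) f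

lemma pderivL_cons {d : ℕ} (j : Fin d) (l : List (Fin d)) (α : Fin d → ℕ) (f : Ed d → ℝ) :
    pderivL d (j :: l) α f = (pderivI d j)^[α j] (pderivL d l α f) := rfl

lemma pderivI_iter_contDiff {d : ℕ} (i : Fin d) (n : ℕ) {f : Ed d → ℝ}
    (hf : ContDiff ℝ (⊤ : ℕ∞) f) : ContDiff ℝ (⊤ : ℕ∞) ((pderivI d i)^[n] f) := by
  induction n with
  | zero => exact hf
  | succ n ih => rw [Function.iterate_succ_apply']; exact pderivI_contDiff i ih

lemma pderivI_iter_comm {d : ℕ} (i j : Fin d) (n : ℕ) {f : Ed d → ℝ}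
    (hf : ContDiff ℝ (⊤ : ℕ∞) f) :
    pderivI d i ((pderivI d j)^[n] f) = (pderivI d j)^[n] (pderivI d i f) := by
  induction n with
  | zero => rfl
  | succ n ih =>
    rw [Function.iterate_succ_apply', Function.iterate_succ_apply',
      pderivI_comm i j (pderivI_iter_contDiff j n hf), ih]

lemma pderivL_contDiff {d : ℕ} (l : List (Fin d)) (α : Fin d → ℕ) {f : Ed d → ℝ}
    (hf : ContDiff ℝ (⊤ : ℕ∞) f) : ContDiff ℝ (⊤ : ℕ∞) (pderivL d l α f) := by
  induction l with
  | nil => exact hf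
  | cons j l ih => rw [pderivL_cons]; exact pderivI_iter_contDiff j _ ih

lemma pderivI_pderivL_comm {d : ℕ} (i : Fin d) (l : List (Fin d)) (α : Fin d → ℕ)
    {f : Ed d → ℝ} (hf : ContDiff ℝ (⊤ : ℕ∞) f) :
    pderivI d i (pderivL d l α f) = pderivL d l α (pderivI d i f) := by
  induction l with
  | nil => rfl
  | cons j l ih =>
    rw [pderivL_cons, pderivL_cons, pderivI_iter_comm _ _ _ (pderivL_contDiff l α hf), ih]

lemma pderivL_add_of_notMem {d : ℕ} (i : Fin d) (l : List (Fin d)) (hi : i ∉ l)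
    (α : Fin d → ℕ) (f : Ed d → ℝ) :
    pderivL d l (α + Pi.single i 1) f = pderivL d l α f := by
  induction l with
  | nil => rfl
  | cons j l ih =>
    simp only [List.mem_cons, not_or] at hi
    rw [pderivL_cons, pderivL_cons, ih hi.2]
    have : (α + Pi.single i 1 : Fin d → ℕ) j = α j := by
      simp [Pi.single_apply, Ne.symm hi.1]
    rw [this]

lemma pderivL_add_of_mem {d : ℕ} (i : Fin d) (l : List (Fin d)) (hi : i ∈ l) (hl : l.Nodup)
    (α : Fin d → ℕ) {f : Ed d → ℝ} (hf : ContDiff ℝ (⊤ : ℕ∞) f) :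
    pderivL d l (α + Pi.single i 1) f = pderivL d l α (pderivI d i f) := by
  induction l with
  | nil => simp at hi
  | cons j l ih =>
    rw [List.nodup_cons] at hl
    rw [pderivL_cons, pderivL_cons]
    by_cases hji : j = i
    · subst hji
      rw [pderivL_add_of_notMem _ _ hl.1]
      have : (α + Pi.single j 1 : Fin d → ℕ) j = α j + 1 := by simp
      rw [this, Function.iterate_succ_apply, pderivI_pderivL_comm _ _ _ hf]
    · have hi' : i ∈ l := by
        rcases List.mem_cons.1 hi with h | h
        · exact absurd h.symm hji
        · exact h
      rw [ih hi' hl.2]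
      have : (α + Pi.single i 1 : Fin d → ℕ) j = α j := by
        simp [Pi.single_apply, hji]
      rw [this]

lemma pderivA_add {d : ℕ} (i : Fin d) (α : Fin d → ℕ) {f : Ed d → ℝ}
    (hf : ContDiff ℝ (⊤ : ℕ∞) f) :
    pderivA d (α + Pi.single i 1) f = pderivA d α (pderivI d i f) :=
  pderivL_add_of_mem i _ (List.mem_finRange i) (List.nodup_finRange d) α hf

lemma pderivA_zero {d : ℕ} (f : Ed d → ℝ) : pderivA d 0 f = f := by
  change pderivL d (List.finRange d) 0 f = f
  induction List.finRange d with
  | nil => rfl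
  | cons j l ih => rw [pderivL_cons, ih]; rfl

lemma pderivI_mul {d : ℕ} (i : Fin d) {f g : Ed d → ℝ}
    (hf : ContDiff ℝ (⊤ : ℕ∞) f) (hg : ContDiff ℝ (⊤ : ℕ∞) g) (x : Ed d) :
    pderivI d i (fun y => f y * g y) x = f x * pderivI d i g x + g x * pderivI d i f x := by
  unfold pderivI
  rw [fderiv_fun_mul (hf.differentiable (by simp) x) (hg.differentiable (by simp) x)]
  simp

lemma weak_test {d : ℕ} {Ω : Set (Ed d)} (hΩ : IsOpen Ω) (i : Fin d) {f f' : Ed d → ℝ}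
    (hf : LocallyIntegrableOn f Ω volume) (hf' : LocallyIntegrableOn f' Ω volume)
    (hw : ∀ φ, IsTestFun d Ω φ → ∫ x in Ω, f x * pderivI d i φ x = -∫ x in Ω, f' x * φ x)
    {G H : Ed d → ℝ} {K : Set (Ed d)} (hK : IsCompact K) (hKΩ : K ⊆ Ω)
    (hGK : ∀ x, x ∉ K → G x = 0) (hHK : ∀ x, x ∉ K → H x = 0)
    (hG : Integrable G) (hH : Integrable H) {M : ℝ}
    (hGM : ∀ᵐ x, |G x| ≤ M) (hHM : ∀ᵐ x, |H x| ≤ M)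
    (hGH : ∀ ψ : Ed d → ℝ, ContDiff ℝ (⊤ : ℕ∞) ψ →
      ∫ x, G x * pderivI d i ψ x = -∫ x, H x * ψ x) :
    ∫ x in Ω, f x * H x = -∫ x in Ω, f' x * G x := by
  obtain ⟨δ, hδ, hδΩ⟩ := hK.exists_cthickening_subset_open hΩ hKΩ
  set K' := cthickening δ K with hK'
  have hK'c : IsCompact K' := hK.cthickening
  let b : ℕ → ContDiffBump (0 : Ed d) := fun n =>
    ⟨δ / (n + 1) / 2, δ / (n + 1), by positivity, half_lt_self (by positivity)⟩
  let η : ℕ → Ed d → ℝ := fun n => (b n).normed volume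
  have hb0 : Tendsto (fun n => (b n).rOut) atTop (𝓝 0) := by
    have := tendsto_one_div_add_atTop_nhds_zero_nat (𝕜 := ℝ)
    have h2 := this.const_mul δ
    simpa [b, div_eq_mul_inv] using h2
  have hb1 : ∀ᶠ n in atTop, (b n).rOut ≤ 2 * (b n).rIn := by
    refine Eventually.of_forall fun n => ?_
    simp only [b]; linarith
  have hbδ : ∀ n, (b n).rOut ≤ δ := by
    intro n
    simp only [b]
    apply div_le_self hδ.le
    have : (0:ℝ) ≤ n := Nat.cast_nonneg n
    linarith
  have hηs : ∀ n, ContDiff ℝ (⊤ : ℕ∞) (η n) := fun n => (b n).contDiff_normed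
  have hηc : ∀ n, HasCompactSupport (η n) := fun n => (b n).hasCompactSupport_normed
  let C : ℕ → (Ed d → ℝ) → Ed d → ℝ := fun n F =>
    MeasureTheory.convolution (η n) F (ContinuousLinearMap.lsmul ℝ ℝ) volume
  have hC : ∀ n F x, C n F x = ∫ t, η n (x - t) * F t := by
    intro n F x
    simp only [C]
    rw [MeasureTheory.convolution_eq_swap]
    rfl
  have hCt : ∀ F, Integrable F → ∀ᵐ x, Tendsto (fun n => C n F x) atTop (𝓝 (F x)) := fun F hF =>
    ContDiffBump.ae_convolution_tendsto_right_of_locallyIntegrable hb0 hb1 hF.locallyIntegrable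
  have hCs : ∀ n F, Integrable F → ContDiff ℝ (⊤ : ℕ∞) (C n F) := fun n F hF =>
    (hηc n).contDiff_convolution_left _ (hηs n) hF.locallyIntegrable
  have hCM : ∀ n F, (∀ᵐ x, |F x| ≤ M) → ∀ x, |C n F x| ≤ M := by
    intro n F hF x
    rw [hC]
    have h1 : ∫ t, η n (x - t) * M = M := by
      rw [integral_mul_const, integral_sub_left_eq_self (η n) volume x]
      simp only [η]
      rw [ContDiffBump.integral_normed, one_mul]
    rw [← h1, ← Real.norm_eq_abs]
    apply norm_integral_le_of_norm_le
    · apply Integrable.mul_const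
      exact ((b n).integrable_normed).comp_sub_left x
    · filter_upwards [hF] with t ht
      rw [norm_mul, Real.norm_eq_abs, Real.norm_eq_abs, abs_of_nonneg ((b n).nonneg_normed _)]
      exact mul_le_mul_of_nonneg_left ht ((b n).nonneg_normed _)
  have hCK : ∀ n F, (∀ x, x ∉ K → F x = 0) → ∀ x, x ∉ K' → C n F x = 0 := by
    intro n F hF x hx
    rw [hC]
    rw [← integral_zero (Ed d) ℝ]
    congr 1
    funext t
    by_cases ht : t ∈ K
    · have : η n (x - t) = 0 := by
        by_contra h0
        have hm : x - t ∈ Function.support (η n) := h0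
        simp only [η] at hm
        rw [ContDiffBump.support_normed_eq, mem_ball_zero_iff] at hm
        apply hx
        apply mem_cthickening_of_dist_le x t δ K ht
        rw [dist_eq_norm]
        exact hm.le.trans (hbδ n)
      simp [this]
    · simp [hF t ht]
  have hCd : ∀ n, pderivI d i (C n G) = C n H := by
    intro n
    funext x
    have h1 := (hηc n).hasFDerivAt_convolution_left (ContinuousLinearMap.lsmul ℝ ℝ)
      ((hηs n).of_le (by simp)) hG.locallyIntegrable x
    unfold pderivI
    rw [h1.fderiv, MeasureTheory.convolution_eq_swap, ContinuousLinearMap.integral_apply]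
    · have h2 := hGH (fun t => η n (x - t)) ((hηs n).comp (contDiff_const.sub contDiff_id))
      have h3 : ∀ t, pderivI d i (fun t => η n (x - t)) t
          = - fderiv ℝ (η n) (x - t) (EuclideanSpace.single i 1) := by
        intro t
        unfold pderivI
        have h4 : HasFDerivAt (fun t => η n (x - t))
            ((fderiv ℝ (η n) (x - t)).comp (-(ContinuousLinearMap.id ℝ (Ed d)))) t := by
          have h5 : HasFDerivAt (fun t : Ed d => x - t) (-(ContinuousLinearMap.id ℝ (Ed d))) t :=
            (hasFDerivAt_id t).const_sub x
          exact HasFDerivAt.comp t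
            (((hηs n).differentiable (by simp) (x - t)).hasFDerivAt) h5
        rw [h4.fderiv]
        simp
      rw [hC]
      simp only [h3, mul_neg, integral_neg, neg_inj] at h2
      simp only [mul_comm (η n _)]
      rw [← h2]
      congr 1
      funext t
      simp [ContinuousLinearMap.precompL_apply, mul_comm]
    · have := (((hηc n).fderiv ℝ).convolutionExists_left
        ((ContinuousLinearMap.lsmul ℝ ℝ : ℝ →L[ℝ] ℝ →L[ℝ] ℝ).precompL (Ed d))
        ((hηs n).continuous_fderiv (by simp)) hG.locallyIntegrable x)
      exact this.integrable_swap
  have hCtest : ∀ n, IsTestFun d Ω (C n G) := by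
    intro n
    have hsub : tsupport (C n G) ⊆ K' := by
      refine closure_minimal ?_ isClosed_cthickening
      intro x hx
      by_contra hxn
      exact hx (hCK n G hGK x hxn)
    exact ⟨hCs n G hG, hK'c.of_isClosed_subset (isClosed_tsupport _) hsub, hsub.trans hδΩ⟩
  have heq : ∀ n, ∫ x in Ω, f x * C n H x = -∫ x in Ω, f' x * C n G x := by
    intro n
    rw [← hCd n]
    exact hw _ (hCtest n)
  have hlim : ∀ (k F : Ed d → ℝ), LocallyIntegrableOn k Ω volume → Integrable F →
      (∀ᵐ x, |F x| ≤ M) → (∀ x, x ∉ K → F x = 0) →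
      Tendsto (fun n => ∫ x in Ω, k x * C n F x) atTop (𝓝 (∫ x in Ω, k x * F x)) := by
    intro k F hk hF hFM hFK
    have hkK : IntegrableOn k K' volume := hk.integrableOn_compact_subset hδΩ hK'c
    apply tendsto_integral_of_dominated_convergence (K'.indicator fun x => |k x| * M)
    · intro n
      have := hk.aestronglyMeasurable
      exact this.mul (hCs n F hF).continuous.aestronglyMeasurable
    · have : IntegrableOn (fun x => |k x| * M) K' volume := (hkK.abs).mul_const M
      exact (this.integrable_indicator isClosed_cthickening.measurableSet).integrableOn
    · intro n
      refine Eventually.of_forall fun x => ?_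
      by_cases hx : x ∈ K'
      · rw [indicator_of_mem hx, norm_mul, Real.norm_eq_abs, Real.norm_eq_abs]
        exact mul_le_mul_of_nonneg_left (hCM n F hFM x) (abs_nonneg _)
      · rw [indicator_of_notMem hx, hCK n F hFK x hx]
        simp
    · apply ae_restrict_of_ae
      filter_upwards [hCt F hF] with x hx
      exact hx.const_mul _
  have l1 := hlim f H hf hH hHM hHK
  have l2 := (hlim f' G hf' hG hGM hGK).neg
  refine tendsto_nhds_unique l1 ?_
  simpa only [heq] using l2

/-! ### The first order product rule for weak derivatives -/

/-- Local boundedness (a.e.) on `Ω`. -/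
def LocBdd (d : ℕ) (Ω : Set (Ed d)) (g : Ed d → ℝ) : Prop :=
  ∀ K : Set (Ed d), K ⊆ Ω → IsCompact K → ∃ M : ℝ, 0 ≤ M ∧ ∀ᵐ x ∂volume, x ∈ K → |g x| ≤ M

/-- First order weak derivative. -/
def W1 (d : ℕ) (Ω : Set (Ed d)) (i : Fin d) (f f' : Ed d → ℝ) : Prop :=
  LocallyIntegrableOn f Ω volume ∧ LocallyIntegrableOn f' Ω volume ∧
    ∀ φ, IsTestFun d Ω φ → ∫ x in Ω, f x * pderivI d i φ x = -∫ x in Ω, f' x * φ x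

lemma locInt_mul {d : ℕ} {Ω : Set (Ed d)} (hΩ : IsOpen Ω) {f g : Ed d → ℝ}
    (hf : LocallyIntegrableOn f Ω volume) (hg : LocallyIntegrableOn g Ω volume)
    (hb : LocBdd d Ω g) : LocallyIntegrableOn (fun x => f x * g x) Ω volume := by
  rw [locallyIntegrableOn_iff hΩ.isLocallyClosed]
  intro K hK hKc
  obtain ⟨M, hM, hbM⟩ := hb K hK hKc
  have h1 := hf.integrableOn_compact_subset hK hKc
  have h2 := hg.integrableOn_compact_subset hK hKc
  refine Integrable.mono' (g := fun x => |f x| * M) (h1.abs.mul_const M)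
    (h1.aestronglyMeasurable.mul h2.aestronglyMeasurable) ?_
  filter_upwards [ae_restrict_of_ae hbM, ae_restrict_mem hKc.measurableSet] with x hx hxK
  rw [norm_mul, Real.norm_eq_abs, Real.norm_eq_abs]
  exact mul_le_mul_of_nonneg_left (hx hxK) (abs_nonneg _)

lemma integrable_mul_cont {d : ℕ} {Ω K : Set (Ed d)} {f φ : Ed d → ℝ}
    (hf : LocallyIntegrableOn f Ω volume) (hφ : Continuous φ) (hK : IsCompact K) (hKΩ : K ⊆ Ω)
    (h0 : ∀ x, x ∉ K → φ x = 0) : Integrable (fun x => f x * φ x) volume := by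
  have h1 := hf.integrableOn_compact_subset hKΩ hK
  have h2 : IntegrableOn (fun x => f x * φ x) K volume := h1.mul_continuousOn hφ.continuousOn hK
  rw [integrableOn_iff_integrable_of_support_subset] at h2
  · exact h2
  · intro x hx
    by_contra hxK
    exact hx (by simp [h0 x hxK])

lemma W1.mul {d : ℕ} {Ω : Set (Ed d)} (hΩ : IsOpen Ω) {i : Fin d} {f f' g g' : Ed d → ℝ}
    (hf : W1 d Ω i f f') (hg : W1 d Ω i g g') (hb : LocBdd d Ω g) (hb' : LocBdd d Ω g') :
    W1 d Ω i (fun x => f x * g x) (fun x => f' x * g x + f x * g' x) := by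
  have i1 := locInt_mul hΩ hf.1 hg.1 hb
  have i2 := locInt_mul hΩ hf.2.1 hg.1 hb
  have i3 := locInt_mul hΩ hf.1 hg.2.1 hb'
  refine ⟨i1, i2.add i3, ?_⟩
  intro φ hφ
  set K := tsupport φ with hKdef
  have hK : IsCompact K := hφ.2.1
  have hKΩ : K ⊆ Ω := hφ.2.2
  have hφ' := pderivI_testFun i hφ
  have c1 : Continuous φ := hφ.1.continuous
  have c2 : Continuous (pderivI d i φ) := hφ'.1.continuous
  have z1 : ∀ x, x ∉ K → φ x = 0 := fun x hx => image_eq_zero_of_notMem_tsupport hx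
  have z2 : ∀ x, x ∉ K → pderivI d i φ x = 0 := fun x hx =>
    image_eq_zero_of_notMem_tsupport (fun h => hx (pderivI_tsupport i φ h))
  have J : ∀ {h ψ : Ed d → ℝ}, LocallyIntegrableOn h Ω volume → Continuous ψ →
      (∀ x, x ∉ K → ψ x = 0) → Integrable (fun x => h x * ψ x) volume := fun hh hψ h0 =>
    integrable_mul_cont hh hψ hK hKΩ h0
  obtain ⟨B1, hB1⟩ := hφ.2.1.exists_bound_of_continuous c1
  obtain ⟨B2, hB2⟩ := hφ'.2.1.exists_bound_of_continuous c2
  obtain ⟨M1, hM1, hbM1⟩ := hb K hKΩ hK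
  obtain ⟨M2, hM2, hbM2⟩ := hb' K hKΩ hK
  have hB1' : 0 ≤ B1 := (norm_nonneg _).trans (hB1 0)
  have hB2' : 0 ≤ B2 := (norm_nonneg _).trans (hB2 0)
  have key := weak_test hΩ i hf.1 hf.2.1 hf.2.2 (G := fun x => g x * φ x)
    (H := fun x => g' x * φ x + g x * pderivI d i φ x) hK hKΩ
    (fun x hx => by simp [z1 x hx]) (fun x hx => by simp [z1 x hx, z2 x hx])
    (J hg.1 c1 z1) ((J hg.2.1 c1 z1).add (J hg.1 c2 z2)) (M := M1 * B1 + M2 * B1 + M1 * B2)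
    ?_ ?_ ?_
  · have e1 : ∫ x in Ω, f x * (g' x * φ x + g x * pderivI d i φ x)
        = (∫ x in Ω, f x * g' x * φ x) + ∫ x in Ω, f x * g x * pderivI d i φ x := by
      rw [← integral_add (J i3 c1 z1).integrableOn (J i1 c2 z2).integrableOn]
      congr 1; funext x; ring
    have e2 : ∫ x in Ω, f' x * (g x * φ x) = ∫ x in Ω, f' x * g x * φ x := by
      congr 1; funext x; ring
    have e3 : ∫ x in Ω, (f' x * g x + f x * g' x) * φ x
        = (∫ x in Ω, f' x * g x * φ x) + ∫ x in Ω, f x * g' x * φ x := by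
      rw [← integral_add (J i2 c1 z1).integrableOn (J i3 c1 z1).integrableOn]
      congr 1; funext x; ring
    rw [e1, e2] at key
    rw [e3]
    linarith
  · filter_upwards [hbM1] with x hx
    by_cases hxK : x ∈ K
    · have := mul_le_mul (hx hxK) (hB1 x) (norm_nonneg _) hM1
      rw [abs_mul]
      rw [Real.norm_eq_abs] at this
      have : 0 ≤ M2 * B1 := by positivity
      have : 0 ≤ M1 * B2 := by positivity
      linarith
    · simp only [z1 x hxK, mul_zero, abs_zero]
      positivity
  · filter_upwards [hbM1, hbM2] with x hx hx2
    by_cases hxK : x ∈ K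
    · have t1 := mul_le_mul (hx2 hxK) (hB1 x) (norm_nonneg _) hM2
      have t2 := mul_le_mul (hx hxK) (hB2 x) (norm_nonneg _) hM1
      rw [Real.norm_eq_abs, ← abs_mul] at t1 t2
      have t3 := abs_add_le (g' x * φ x) (g x * pderivI d i φ x)
      have : 0 ≤ M1 * B1 := by positivity
      linarith
    · simp only [z1 x hxK, z2 x hxK, mul_zero, add_zero, abs_zero]
      positivity
  · intro ψ hψ
    have hψ' := pderivI_contDiff i hψ
    have htest : IsTestFun d Ω (fun x => φ x * ψ x) :=
      ⟨hφ.1.mul hψ, hφ.2.1.mul_right, (tsupport_mul_subset_left).trans hKΩ⟩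
    have h1 := hg.2.2 _ htest
    have toΩ : ∀ h : Ed d → ℝ, (∀ x, x ∉ K → h x = 0) → ∫ x in Ω, h x = ∫ x, h x := by
      intro h hh
      exact setIntegral_eq_integral_of_forall_compl_eq_zero fun x hx => hh x fun hxK => hx (hKΩ hxK)
    rw [toΩ _ (fun x hx => by rw [pderivI_mul i hφ.1 hψ]; simp [z1 x hx, z2 x hx]),
      toΩ _ (fun x hx => by simp [z1 x hx])] at h1
    have a1 : Integrable (fun x => g x * (φ x * pderivI d i ψ x)) volume :=
      J hg.1 (c1.mul hψ'.continuous) (fun x hx => by simp [z1 x hx])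
    have a2 : Integrable (fun x => g x * (ψ x * pderivI d i φ x)) volume :=
      J hg.1 (hψ.continuous.mul c2) (fun x hx => by simp [z2 x hx])
    have a3 : Integrable (fun x => g' x * (φ x * ψ x)) volume :=
      J hg.2.1 (c1.mul hψ.continuous) (fun x hx => by simp [z1 x hx])
    have e1 : ∫ x, g x * pderivI d i (fun x => φ x * ψ x) x
        = (∫ x, g x * (φ x * pderivI d i ψ x)) + ∫ x, g x * (ψ x * pderivI d i φ x) := by
      rw [← integral_add a1 a2]
      congr 1; funext x; rw [pderivI_mul i hφ.1 hψ]; ring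
    have e2 : ∫ x, (g' x * φ x + g x * pderivI d i φ x) * ψ x
        = (∫ x, g' x * (φ x * ψ x)) + ∫ x, g x * (ψ x * pderivI d i φ x) := by
      rw [← integral_add a3 a2]
      congr 1; funext x; ring
    have e3 : ∫ x, g x * φ x * pderivI d i ψ x = ∫ x, g x * (φ x * pderivI d i ψ x) := by
      congr 1; funext x; ring
    rw [e2, e3]
    rw [e1] at h1
    linarith

lemma locInt_zero {d : ℕ} {Ω : Set (Ed d)} :
    LocallyIntegrableOn (fun _ : Ed d => (0 : ℝ)) Ω volume := fun _ _ =>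
  ⟨Ω, self_mem_nhdsWithin, integrableOn_zero⟩

lemma W1.zero {d : ℕ} {Ω : Set (Ed d)} {i : Fin d} : W1 d Ω i (fun _ => 0) (fun _ => 0) :=
  ⟨locInt_zero, locInt_zero, fun φ _ => by simp⟩

lemma W1.add {d : ℕ} {Ω : Set (Ed d)} {i : Fin d} {f f' g g' : Ed d → ℝ}
    (hf : W1 d Ω i f f') (hg : W1 d Ω i g g') :
    W1 d Ω i (fun x => f x + g x) (fun x => f' x + g' x) := by
  refine ⟨hf.1.add hg.1, hf.2.1.add hg.2.1, ?_⟩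
  intro φ hφ
  have hφ' := pderivI_testFun i hφ
  have J : ∀ {h ψ : Ed d → ℝ}, LocallyIntegrableOn h Ω volume → IsTestFun d Ω ψ →
      IntegrableOn (fun x => h x * ψ x) Ω volume := fun hh hψ =>
    (integrable_mul_cont hh hψ.1.continuous hψ.2.1 hψ.2.2
      (fun x hx => image_eq_zero_of_notMem_tsupport hx)).integrableOn
  simp only [add_mul]
  rw [integral_add (J hf.1 hφ') (J hg.1 hφ'), integral_add (J hf.2.1 hφ) (J hg.2.1 hφ),
    hf.2.2 φ hφ, hg.2.2 φ hφ]
  ring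

/-! ### Higher order Leibniz rule -/

lemma mem_multiIdx {d m : ℕ} {α : Fin d → ℕ} : α ∈ multiIdx d m ↔ ∑ i, α i ≤ m := by
  unfold multiIdx
  simp only [Finset.mem_filter, Fintype.mem_piFinset, Finset.mem_range, and_iff_right_iff_imp]
  intro h i
  have : α i ≤ ∑ i, α i := Finset.single_le_sum (fun _ _ => Nat.zero_le _) (Finset.mem_univ i)
  omega

lemma sum_add_single {d : ℕ} (α : Fin d → ℕ) (i : Fin d) :
    ∑ j, (α + Pi.single i 1 : Fin d → ℕ) j = ∑ j, α j + 1 := by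
  simp [Finset.sum_add_distrib]

lemma weak_unique {d : ℕ} {Ω : Set (Ed d)} (hΩ : IsOpen Ω) {α : Fin d → ℕ} {u w w' : Ed d → ℝ}
    (h : HasWeakDerivOn d Ω α u w) (h' : HasWeakDerivOn d Ω α u w') :
    w =ᵐ[volume.restrict Ω] w' := by
  have := hΩ.ae_eq_zero_of_integral_contDiff_smul_eq_zero (f := fun x => w x - w' x)
    (h.2.1.sub h'.2.1) ?_
  · rw [Filter.EventuallyEq, ae_restrict_iff' hΩ.measurableSet]
    filter_upwards [this] with x hx hxΩ
    exact sub_eq_zero.1 (hx hxΩ)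
  · intro φ hφ hφc hφΩ
    have ht : IsTestFun d Ω φ := ⟨hφ, hφc, hφΩ⟩
    have h1 := h.2.2 φ ht
    rw [h'.2.2 φ ht] at h1
    have h2 : ∫ x in Ω, w' x * φ x = ∫ x in Ω, w x * φ x :=
      mul_left_cancel₀ (pow_ne_zero _ (by norm_num)) h1
    have J : ∀ {h : Ed d → ℝ}, LocallyIntegrableOn h Ω volume →
        IntegrableOn (fun x => h x * φ x) Ω volume := fun hh =>
      (integrable_mul_cont hh hφ.continuous hφc hφΩ
        (fun x hx => image_eq_zero_of_notMem_tsupport hx)).integrableOn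
    have h3 : ∫ x in Ω, φ x • (w x - w' x) = 0 := by
      have : ∀ x, φ x • (w x - w' x) = w x * φ x - w' x * φ x := by
        intro x; rw [smul_eq_mul]; ring
      simp only [this]
      rw [integral_sub (J h.2.1) (J h'.2.1), h2, sub_self]
    rw [← h3]
    symm
    apply setIntegral_eq_integral_of_forall_compl_eq_zero
    intro x hx
    rw [image_eq_zero_of_notMem_tsupport (fun hh => hx (hφΩ hh)), zero_smul]

lemma weak_step {d : ℕ} {Ω : Set (Ed d)} {α : Fin d → ℕ} {i : Fin d} {u w w' : Ed d → ℝ}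
    (h : HasWeakDerivOn d Ω α u w) (h' : HasWeakDerivOn d Ω (α + Pi.single i 1) u w') :
    W1 d Ω i w w' := by
  refine ⟨h.2.1, h'.2.1, ?_⟩
  intro φ hφ
  have h1 := h.2.2 _ (pderivI_testFun i hφ)
  have h2 := h'.2.2 _ hφ
  rw [pderivA_add i α hφ.1, h1, sum_add_single, pow_succ, mul_assoc] at h2
  have := mul_left_cancel₀ (pow_ne_zero _ (by norm_num)) h2
  rw [this]; ring

/-- The Leibniz sum attached to a list of pairs of multi-indices. -/
def leibSum {d : ℕ} (L : List ((Fin d → ℕ) × (Fin d → ℕ))) (Du Dv : (Fin d → ℕ) → Ed d → ℝ) :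
    Ed d → ℝ :=
  fun x => (L.map fun q => Du q.1 x * Dv q.2 x).sum

/-- One differentiation step on Leibniz lists. -/
def leibStep {d : ℕ} (i : Fin d) (L : List ((Fin d → ℕ) × (Fin d → ℕ))) :
    List ((Fin d → ℕ) × (Fin d → ℕ)) :=
  L.flatMap fun q => [(q.1 + Pi.single i 1, q.2), (q.1, q.2 + Pi.single i 1)]

lemma leib_W1 {d m : ℕ} {Ω : Set (Ed d)} (hΩ : IsOpen Ω) {u v : Ed d → ℝ}
    {Du Dv : (Fin d → ℕ) → Ed d → ℝ} (hu : IsWeakDerivFamily d Ω m u Du)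
    (hv : IsWeakDerivFamily d Ω m v Dv) (hb : ∀ γ ∈ multiIdx d m, LocBdd d Ω (Dv γ))
    (i : Fin d) (L : List ((Fin d → ℕ) × (Fin d → ℕ)))
    (hL : ∀ q ∈ L, ∑ j, q.1 j + 1 ≤ m ∧ ∑ j, q.2 j + 1 ≤ m) :
    W1 d Ω i (leibSum L Du Dv) (leibSum (leibStep i L) Du Dv) := by
  induction L with
  | nil => exact W1.zero
  | cons q L ih =>
    have ih' := ih fun q hq => hL q (List.mem_cons_of_mem _ hq)
    obtain ⟨h1, h2⟩ := hL q List.mem_cons_self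
    have m1 : q.1 ∈ multiIdx d m := mem_multiIdx.2 (by omega)
    have m2 : q.2 ∈ multiIdx d m := mem_multiIdx.2 (by omega)
    have m3 : q.1 + Pi.single i 1 ∈ multiIdx d m := mem_multiIdx.2 (by rw [sum_add_single]; omega)
    have m4 : q.2 + Pi.single i 1 ∈ multiIdx d m := mem_multiIdx.2 (by rw [sum_add_single]; omega)
    have w1 := weak_step (hu _ m1) (hu _ m3)
    have w2 := weak_step (hv _ m2) (hv _ m4)
    have := (W1.mul hΩ w1 w2 (hb _ m2) (hb _ m4)).add ih'
    convert this using 2 with x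
    all_goals simp [leibSum, leibStep, add_assoc]

lemma leibniz (d : ℕ) (n : ℕ) : ∀ α : Fin d → ℕ, ∑ j, α j = n →
    ∃ L : List ((Fin d → ℕ) × (Fin d → ℕ)), (∀ q ∈ L, q.1 + q.2 = α) ∧
      ∀ (Ω : Set (Ed d)) (m : ℕ) (u v : Ed d → ℝ) (Du Dv : (Fin d → ℕ) → Ed d → ℝ),
        IsOpen Ω → n ≤ m → IsWeakDerivFamily d Ω m u Du → IsWeakDerivFamily d Ω m v Dv →
        (∀ γ ∈ multiIdx d m, LocBdd d Ω (Dv γ)) →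
        HasWeakDerivOn d Ω α (u * v) (leibSum L Du Dv) := by
  induction n with
  | zero =>
    intro α hα
    have hα0 : α = 0 := by
      funext j
      exact (Finset.sum_eq_zero_iff.1 hα) j (Finset.mem_univ j)
    subst hα0
    refine ⟨[(0, 0)], by simp, ?_⟩
    intro Ω m u v Du Dv hΩ _ hu hv hb
    have m0 : (0 : Fin d → ℕ) ∈ multiIdx d m := mem_multiIdx.2 (by simp)
    have self : ∀ {w w' : Ed d → ℝ}, HasWeakDerivOn d Ω 0 w w' → w =ᵐ[volume.restrict Ω] w' := by
      intro w w' h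
      refine weak_unique hΩ ⟨h.1, h.1, fun φ _ => ?_⟩ h
      rw [pderivA_zero]; simp
    have eu := self (hu 0 m0)
    have ev := self (hv 0 m0)
    have hl := locInt_mul hΩ (hu 0 m0).2.1 (hv 0 m0).2.1 (hb 0 m0)
    have e : (u * v) =ᵐ[volume.restrict Ω] leibSum [(0, 0)] Du Dv := by
      filter_upwards [eu, ev] with x h1 h2
      simp [leibSum, h1, h2]
    have hl' : LocallyIntegrableOn (leibSum [(0, 0)] Du Dv) Ω volume := by
      convert hl using 2 with x
      simp [leibSum]
    have hluv : LocallyIntegrableOn (u * v) Ω volume := by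
      rw [locallyIntegrableOn_iff hΩ.isLocallyClosed] at hl' ⊢
      intro K hK hKc
      exact (hl' K hK hKc).congr (ae_mono (Measure.restrict_mono hK le_rfl) e.symm)
    refine ⟨hluv, hl', fun φ _ => ?_⟩
    rw [pderivA_zero]
    simp only [Pi.zero_apply, Finset.sum_const_zero, pow_zero, one_mul]
    apply integral_congr_ae
    filter_upwards [e] with x hx
    rw [hx]
  | succ n ih =>
    intro α hα
    obtain ⟨i, hi⟩ : ∃ i, α i ≠ 0 := by
      by_contra hcon
      push Not at hcon
      simp [hcon] at hα
    obtain ⟨β, hβ⟩ : ∃ β : Fin d → ℕ, α = β + Pi.single i 1 := by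
      refine ⟨α - Pi.single i 1, ?_⟩
      funext j
      by_cases hj : j = i
      · subst hj
        simp only [Pi.add_apply, Pi.sub_apply, Pi.single_eq_same]
        omega
      · simp [Pi.single_apply, hj]
    subst hβ
    rw [sum_add_single] at hα
    obtain ⟨L, hL, hw⟩ := ih β (by omega)
    refine ⟨leibStep i L, ?_, ?_⟩
    · intro q hq
      simp only [leibStep, List.mem_flatMap, List.mem_cons, List.not_mem_nil, or_false] at hq
      obtain ⟨r, hr, h | h⟩ := hq
      · subst h; rw [← hL r hr]; simp only; abel
      · subst h; rw [← hL r hr]; simp only; abel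
    · intro Ω m u v Du Dv hΩ hm hu hv hb
      have h0 := hw Ω m u v Du Dv hΩ (by omega) hu hv hb
      have h1 := leib_W1 hΩ hu hv hb i L (by
        intro q hq
        have h2 : ∑ j, (q.1 j + q.2 j) = n := by
          have h3 := hL q hq
          have h4 : ∑ j, (q.1 + q.2) j = ∑ j, β j := by rw [h3]
          simp only [Pi.add_apply] at h4
          omega
        rw [Finset.sum_add_distrib] at h2
        omega)
      refine ⟨h0.1, h1.2.1, fun φ hφ => ?_⟩
      rw [pderivA_add i β hφ.1, h0.2.2 _ (pderivI_testFun i hφ), h1.2.2 φ hφ, sum_add_single]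
      ring

/-! ### The model domain -/

lemma rhoModel_continuous (d ℓ : ℕ) : Continuous (rhoModel d ℓ) := by
  unfold rhoModel
  fun_prop

lemma rhoModel_pos {d ℓ : ℕ} {x : Ed d} (hx : x ∈ ModelDomain d ℓ) : 0 < rhoModel d ℓ x := by
  unfold rhoModel
  refine lt_min one_pos (Real.sqrt_pos.2 ?_)
  simp only [ModelDomain, RStar, mem_compl_iff, mem_setOf_eq, not_forall] at hx
  obtain ⟨i, hi, hxi⟩ := hx
  refine Finset.sum_pos' (fun j _ => sq_nonneg _) ⟨i, by simp [hi], by positivity⟩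

lemma modelDomain_isOpen (d ℓ : ℕ) : IsOpen (ModelDomain d ℓ) := by
  unfold ModelDomain
  rw [isOpen_compl_iff]
  unfold RStar
  simp only [setOf_forall]
  refine isClosed_iInter fun i => isClosed_iInter fun _ => isClosed_eq (by fun_prop) continuous_const

lemma inf_bound {d ℓ m : ℕ} {Dv : (Fin d → ℕ) → Ed d → ℝ}
    (h : ∀ α ∈ multiIdx d m, eLpNorm (kIntegrandInf d (rhoModel d ℓ) 0 α (Dv α)) ⊤
      (volume.restrict (ModelDomain d ℓ)) < ⊤) {γ : Fin d → ℕ} (hγ : γ ∈ multiIdx d m) :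
    ∀ᵐ x ∂(volume.restrict (ModelDomain d ℓ)),
      rhoModel d ℓ x ^ ((∑ i, γ i : ℕ) : ℝ) * |Dv γ x|
        ≤ KnormInfP d (ModelDomain d ℓ) (rhoModel d ℓ) m 0 Dv := by
  have h1 := ae_le_eLpNormEssSup (f := kIntegrandInf d (rhoModel d ℓ) 0 γ (Dv γ))
    (μ := volume.restrict (ModelDomain d ℓ))
  have hlt := h γ hγ
  filter_upwards [h1, ae_restrict_mem (modelDomain_isOpen d ℓ).measurableSet] with x hx hxΩ
  rw [← eLpNorm_exponent_top] at hx
  have h2 := ENNReal.toReal_mono hlt.ne hx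
  rw [toReal_enorm] at h2
  have h3 : ‖kIntegrandInf d (rhoModel d ℓ) 0 γ (Dv γ) x‖
      = rhoModel d ℓ x ^ ((∑ i, γ i : ℕ) : ℝ) * |Dv γ x| := by
    unfold kIntegrandInf
    rw [sub_zero, norm_mul, Real.norm_eq_abs, Real.norm_eq_abs,
      abs_of_nonneg (Real.rpow_nonneg (rhoModel_pos hxΩ).le _)]
  rw [h3] at h2
  refine h2.trans ?_
  unfold KnormInfP
  exact Finset.single_le_sum (f := fun α => (eLpNorm (kIntegrandInf d (rhoModel d ℓ) 0 α (Dv α)) ⊤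
    (volume.restrict (ModelDomain d ℓ))).toReal) (fun _ _ => ENNReal.toReal_nonneg) hγ

lemma KnormInfP_nonneg {d ℓ m : ℕ} {Dv : (Fin d → ℕ) → Ed d → ℝ} :
    0 ≤ KnormInfP d (ModelDomain d ℓ) (rhoModel d ℓ) m 0 Dv :=
  Finset.sum_nonneg fun _ _ => ENNReal.toReal_nonneg

lemma inf_locBdd {d ℓ m : ℕ} {Dv : (Fin d → ℕ) → Ed d → ℝ}
    (h : ∀ α ∈ multiIdx d m, eLpNorm (kIntegrandInf d (rhoModel d ℓ) 0 α (Dv α)) ⊤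
      (volume.restrict (ModelDomain d ℓ)) < ⊤) {γ : Fin d → ℕ} (hγ : γ ∈ multiIdx d m) :
    LocBdd d (ModelDomain d ℓ) (Dv γ) := by
  intro K hK hKc
  rcases K.eq_empty_or_nonempty with rfl | hne
  · exact ⟨0, le_rfl, by simp⟩
  obtain ⟨x0, hx0, hmin⟩ := hKc.exists_isMinOn hne (rhoModel_continuous d ℓ).continuousOn
  have hpos := rhoModel_pos (hK hx0)
  set N := KnormInfP d (ModelDomain d ℓ) (rhoModel d ℓ) m 0 Dv with hN
  have hN0 : 0 ≤ N := KnormInfP_nonneg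
  set s : ℝ := ((∑ i, γ i : ℕ) : ℝ) with hs
  have hs0 : 0 ≤ s := Nat.cast_nonneg _
  refine ⟨N / rhoModel d ℓ x0 ^ s, by positivity, ?_⟩
  have := inf_bound h hγ
  rw [ae_restrict_iff' (modelDomain_isOpen d ℓ).measurableSet] at this
  filter_upwards [this] with x hx hxK
  rw [le_div_iff₀ (by positivity), mul_comm]
  refine le_trans ?_ (hx (hK hxK))
  gcongr
  exact hmin hxK

lemma list_bound {ι : Type*} (L : List ι) (f : ι → ℝ) (B : ℝ) (h : ∀ q ∈ L, |f q| ≤ B) :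
    |(L.map f).sum| ≤ L.length * B := by
  induction L with
  | nil => simp
  | cons q L ih =>
    have h1 := ih fun r hr => h r (List.mem_cons_of_mem _ hr)
    have h2 := h q List.mem_cons_self
    simp only [List.map_cons, List.sum_cons, List.length_cons]
    push_cast
    have h3 := abs_add_le (f q) (L.map f).sum
    linarith

lemma pointwise_bound {d m : ℕ} {r a p N : ℝ} (hr : 0 < r) (hp : 1 ≤ p) (hN : 0 ≤ N)
    {α : Fin d → ℕ} (hα : α ∈ multiIdx d m)
    {L : List ((Fin d → ℕ) × (Fin d → ℕ))} (hL : ∀ q ∈ L, q.1 + q.2 = α)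
    {U V : (Fin d → ℕ) → ℝ}
    (hV : ∀ γ ∈ multiIdx d m, r ^ ((∑ i, γ i : ℕ) : ℝ) * |V γ| ≤ N) :
    (r ^ (((∑ i, α i : ℕ) : ℝ) - a) * |(L.map fun q => U q.1 * V q.2).sum|) ^ p
      ≤ (N * L.length) ^ p *
        ∑ β ∈ multiIdx d m, (r ^ (((∑ i, β i : ℕ) : ℝ) - a) * |U β|) ^ p := by
  have hp0 : 0 < p := by linarith
  set S := ∑ β ∈ multiIdx d m, (r ^ (((∑ i, β i : ℕ) : ℝ) - a) * |U β|) ^ p with hS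
  have hS0 : 0 ≤ S := Finset.sum_nonneg fun β _ => by positivity
  have hU : ∀ β ∈ multiIdx d m, r ^ (((∑ i, β i : ℕ) : ℝ) - a) * |U β| ≤ S ^ (1 / p) := by
    intro β hβ
    have h1 : (r ^ (((∑ i, β i : ℕ) : ℝ) - a) * |U β|) ^ p ≤ S :=
      Finset.single_le_sum (f := fun β => (r ^ (((∑ i, β i : ℕ) : ℝ) - a) * |U β|) ^ p)
        (fun β _ => by positivity) hβ
    have h2 := Real.rpow_le_rpow (by positivity) h1 (by positivity : 0 ≤ 1 / p)
    rwa [← Real.rpow_mul (by positivity), mul_one_div_cancel hp0.ne', Real.rpow_one] at h2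
  have key : r ^ (((∑ i, α i : ℕ) : ℝ) - a) * |(L.map fun q => U q.1 * V q.2).sum|
      ≤ (N * L.length) * S ^ (1 / p) := by
    set w := r ^ (((∑ i, α i : ℕ) : ℝ) - a) with hw
    have hw0 : 0 < w := by positivity
    have h1 : w * |(L.map fun q => U q.1 * V q.2).sum|
        = |(L.map fun q => w * (U q.1 * V q.2)).sum| := by
      rw [List.sum_map_mul_left, abs_mul, abs_of_pos hw0]
    rw [h1]
    refine (list_bound L _ (S ^ (1 / p) * N) ?_).trans (le_of_eq (by ring))
    intro q hq
    have hq' := hL q hq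
    have hsum : ∑ i, α i = ∑ i, q.1 i + ∑ i, q.2 i := by
      rw [← hq', ← Finset.sum_add_distrib]; rfl
    have hαm := mem_multiIdx.1 hα
    have m1 : q.1 ∈ multiIdx d m := mem_multiIdx.2 (by omega)
    have m2 : q.2 ∈ multiIdx d m := mem_multiIdx.2 (by omega)
    have hw' : w = r ^ (((∑ i, q.1 i : ℕ) : ℝ) - a) * r ^ ((∑ i, q.2 i : ℕ) : ℝ) := by
      rw [hw, ← Real.rpow_add hr, hsum]
      congr 1
      push_cast
      ring
    have e : |w * (U q.1 * V q.2)| = (r ^ (((∑ i, q.1 i : ℕ) : ℝ) - a) * |U q.1|)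
        * (r ^ ((∑ i, q.2 i : ℕ) : ℝ) * |V q.2|) := by
      rw [abs_mul, abs_of_pos hw0, abs_mul, hw']; ring
    rw [e]
    exact mul_le_mul (hU _ m1) (hV _ m2) (mul_nonneg (Real.rpow_nonneg hr.le _) (abs_nonneg _))
      (Real.rpow_nonneg hS0 _)
  have h2 := Real.rpow_le_rpow (mul_nonneg (Real.rpow_nonneg hr.le _) (abs_nonneg _)) key hp0.le
  have hNL : 0 ≤ N * (L.length : ℝ) := mul_nonneg hN (Nat.cast_nonneg _)
  rwa [Real.mul_rpow hNL (Real.rpow_nonneg hS0 _), ← Real.rpow_mul hS0,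
    one_div_mul_cancel hp0.ne', Real.rpow_one] at h2

lemma KnormP_congr {d : ℕ} {Ω : Set (Ed d)} (hΩ : IsOpen Ω) (ρ : Ed d → ℝ) (m : ℕ) (a p : ℝ)
    {u : Ed d → ℝ} {D D' : (Fin d → ℕ) → Ed d → ℝ} (h : IsWeakDerivFamily d Ω m u D)
    (h' : IsWeakDerivFamily d Ω m u D') : KnormP d Ω ρ m a p D = KnormP d Ω ρ m a p D' := by
  unfold KnormP
  congr 1
  refine Finset.sum_congr rfl fun α hα => ?_
  apply integral_congr_ae
  filter_upwards [weak_unique hΩ (h α hα) (h' α hα)] with x hx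
  simp only [kIntegrand, hx]

/-- Proposition `mult2a`: for `1 ≤ p < ∞`, `m ∈ ℕ`, `a ∈ ℝ` there is a constant `c` with
`‖u·v|𝒦^m_{a,p}(ℝ^d,ℝ^ℓ_*)‖ ≤ c ‖v|𝒦^m_{0,∞}(ℝ^d,ℝ^ℓ_*)‖ ‖u|𝒦^m_{a,p}(ℝ^d,ℝ^ℓ_*)‖`
for all `u ∈ 𝒦^m_{a,p}` and `v ∈ 𝒦^m_{0,∞}`. -/
theorem statement18 (d ℓ m : ℕ) (hd : 2 ≤ d) (hl : ℓ < d) (hm : 1 ≤ m)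
    (a p : ℝ) (hp : 1 ≤ p) :
    ∃ c : ℝ, 0 < c ∧ ∀ u v : Ed d → ℝ,
      MemKM d ℓ m a p u → MemKMInf d ℓ m 0 v →
      MemKM d ℓ m a p (u * v) ∧
      KnormM d ℓ m a p (u * v) ≤ c * KnormMInf d ℓ m 0 v * KnormM d ℓ m a p u := by
  classical
  have hp0 : 0 < p := by linarith
  choose L hL hw using fun α : Fin d → ℕ => leibniz d (∑ j, α j) α rfl
  set A : ℝ := ∑ α ∈ multiIdx d m, ((L α).length : ℝ) ^ p with hA
  have hA0 : 0 ≤ A := Finset.sum_nonneg fun α _ => by positivity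
  refine ⟨A ^ (1 / p) + 1, by positivity, ?_⟩
  intro u v hu hv
  set Ω := ModelDomain d ℓ with hΩdef
  set ρ := rhoModel d ℓ with hρdef
  have hΩ : IsOpen Ω := modelDomain_isOpen d ℓ
  set Du := Exists.choose hu with hDu
  set Dv := Exists.choose hv with hDv
  have su : KMemData d Ω ρ m a p u Du := Exists.choose_spec hu
  have sv : KMemDataInf d Ω ρ m 0 v Dv := Exists.choose_spec hv
  have nu : KnormM d ℓ m a p u = KnormP d Ω ρ m a p Du := by
    unfold KnormM Knorm
    exact dif_pos hu
  have nv : KnormMInf d ℓ m 0 v = KnormInfP d Ω ρ m 0 Dv := by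
    unfold KnormMInf KnormInf
    exact dif_pos hv
  set N := KnormInfP d Ω ρ m 0 Dv with hN
  have hN0 : 0 ≤ N := KnormInfP_nonneg
  let D : (Fin d → ℕ) → Ed d → ℝ := fun α => leibSum (L α) Du Dv
  have hD : IsWeakDerivFamily d Ω m (u * v) D := fun α hα =>
    hw α Ω m u v Du Dv hΩ (mem_multiIdx.1 hα) su.1 sv.1 (fun γ hγ => inf_locBdd sv.2 hγ)
  let S : Ed d → ℝ := fun x => ∑ β ∈ multiIdx d m, kIntegrand d ρ a p β (Du β) x
  have hS : IntegrableOn S Ω volume := integrable_finsetSum _ fun β hβ => su.2 β hβ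
  have hVall : ∀ᵐ x ∂(volume.restrict Ω), ∀ γ ∈ multiIdx d m,
      ρ x ^ ((∑ i, γ i : ℕ) : ℝ) * |Dv γ x| ≤ N := by
    rw [Finset.eventually_all]
    exact fun γ hγ => inf_bound sv.2 hγ
  have hpt : ∀ α ∈ multiIdx d m, ∀ᵐ x ∂(volume.restrict Ω),
      kIntegrand d ρ a p α (D α) x ≤ (N * (L α).length) ^ p * S x := by
    intro α hα
    filter_upwards [hVall, ae_restrict_mem hΩ.measurableSet] with x hx hxΩ
    exact pointwise_bound (rhoModel_pos hxΩ) hp hN0 hα (hL α) (U := fun β => Du β x)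
      (V := fun β => Dv β x) hx
  have hnn : ∀ α, ∀ᵐ x ∂(volume.restrict Ω), 0 ≤ kIntegrand d ρ a p α (D α) x := by
    intro α
    filter_upwards [ae_restrict_mem hΩ.measurableSet] with x hxΩ
    have := rhoModel_pos hxΩ
    unfold kIntegrand
    positivity
  have hDint : ∀ α ∈ multiIdx d m, IntegrableOn (kIntegrand d ρ a p α (D α)) Ω volume := by
    intro α hα
    refine Integrable.mono' (hS.const_mul ((N * (L α).length) ^ p)) ?_ ?_
    · have h1 : AEMeasurable (D α) (volume.restrict Ω) :=
        (hD α hα).2.1.aestronglyMeasurable.aemeasurable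
      have h2 : Measurable ρ := (rhoModel_continuous d ℓ).measurable
      have h3 : AEMeasurable (fun x => |D α x|) (volume.restrict Ω) := h1.abs
      have : AEMeasurable (kIntegrand d ρ a p α (D α)) (volume.restrict Ω) :=
        (((h2.pow_const _).aemeasurable).mul h3).pow_const p
      exact this.aestronglyMeasurable
    · filter_upwards [hpt α hα, hnn α] with x h1 h2
      rwa [Real.norm_of_nonneg h2]
  have hmem : MemKM d ℓ m a p (u * v) := ⟨D, hD, hDint⟩
  refine ⟨hmem, ?_⟩
  have nuv : KnormM d ℓ m a p (u * v) = KnormP d Ω ρ m a p D := by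
    have : KnormM d ℓ m a p (u * v) = KnormP d Ω ρ m a p (Exists.choose hmem) := by
      unfold KnormM Knorm
      exact dif_pos hmem
    rw [this]
    exact KnormP_congr hΩ ρ m a p (Exists.choose_spec hmem).1 hD
  rw [nuv, nv, nu]
  have hSint : ∫ x in Ω, S x = ∑ β ∈ multiIdx d m, ∫ x in Ω, kIntegrand d ρ a p β (Du β) x :=
    integral_finsetSum _ fun β hβ => su.2 β hβ
  have hS0 : 0 ≤ ∫ x in Ω, S x := by
    apply integral_nonneg_of_ae
    filter_upwards [ae_restrict_mem hΩ.measurableSet] with x hxΩ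
    have := rhoModel_pos hxΩ
    exact Finset.sum_nonneg fun β _ => by unfold kIntegrand; positivity
  have hle : ∑ α ∈ multiIdx d m, ∫ x in Ω, kIntegrand d ρ a p α (D α) x
      ≤ N ^ p * A * ∫ x in Ω, S x := by
    rw [hA, Finset.mul_sum, Finset.sum_mul]
    refine Finset.sum_le_sum fun α hα => ?_
    rw [← Real.mul_rpow hN0 (by positivity), ← integral_const_mul]
    exact integral_mono_ae (hDint α hα) (hS.const_mul _) (hpt α hα)
  have hsum0 : 0 ≤ ∑ α ∈ multiIdx d m, ∫ x in Ω, kIntegrand d ρ a p α (D α) x :=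
    Finset.sum_nonneg fun α _ => integral_nonneg_of_ae (hnn α)
  have h2 := Real.rpow_le_rpow hsum0 hle (by positivity : 0 ≤ 1 / p)
  have e : (N ^ p * A * ∫ x in Ω, S x) ^ (1 / p)
      = A ^ (1 / p) * N * (∫ x in Ω, S x) ^ (1 / p) := by
    rw [Real.mul_rpow (by positivity) hS0, Real.mul_rpow (by positivity) hA0,
      ← Real.rpow_mul hN0, mul_one_div_cancel hp0.ne', Real.rpow_one]
    ring
  rw [e] at h2
  have h3 : KnormP d Ω ρ m a p Du = (∫ x in Ω, S x) ^ (1 / p) := by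
    unfold KnormP
    rw [hSint]
  rw [h3]
  refine le_trans h2 ?_
  have : 0 ≤ (∫ x in Ω, S x) ^ (1 / p) := by positivity
  gcongr
  linarith

end
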